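/- arXiv:2510.08300 — 3 statements merged into one kernel-verified Lean document; each statement's English description precedes it below -/
import Mathlib

section
/- Let H, W, p, q be positive integers with p ≤ H, q ≤ W, and (H−p+1)(W−q+1) ≥ 2. Set n = (H−p+1)(W−q+1) and m = HW. Then the scaling gauge group G_scale(𝒲_CNN(H,W,p,q)) is a strict subset of the scaling gauge group G_scale(ℝ^{n×m}) of the full matrix space: every pair of invertible diagonal matrices belongs to G_scale(ℝ^{n×m}), but some pair of invertible diagonal matrices does not preserve 𝒲_CNN(H,W,p,q). -/
open Matrix

/-- The matrix of a 2D cross-correlation (stride 1, no padding) with kernel `k`: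
rows are indexed by output positions `(a,b)` with `0 ≤ a ≤ H-p`, `0 ≤ b ≤ W-q`,
columns by input positions `(c,d)` with `0 ≤ c < H`, `0 ≤ d < W`, and the entry is
`k (c-a) (d-b)` if `0 ≤ c-a < p` and `0 ≤ d-b < q`, and `0` otherwise. -/
def convMatrix (H W p q : ℕ) (k : Fin p → Fin q → ℝ) :
    Matrix (Fin (H - p + 1) × Fin (W - q + 1)) (Fin H × Fin W) ℝ :=
  fun ab cd =>
    if h : (ab.1 : ℕ) ≤ (cd.1 : ℕ) ∧ (cd.1 : ℕ) - (ab.1 : ℕ) < p ∧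
           (ab.2 : ℕ) ≤ (cd.2 : ℕ) ∧ (cd.2 : ℕ) - (ab.2 : ℕ) < q
    then k ⟨(cd.1 : ℕ) - (ab.1 : ℕ), h.2.1⟩ ⟨(cd.2 : ℕ) - (ab.2 : ℕ), h.2.2.2⟩
    else 0

/-- The convolution weight space `𝒲_CNN(H,W,p,q)`: all matrices of the form `M(k)`. -/
def convSpace (H W p q : ℕ) :
    Set (Matrix (Fin (H - p + 1) × Fin (W - q + 1)) (Fin H × Fin W) ℝ) :=
  Set.range (convMatrix H W p q)

/-- The scaling gauge group of a set `𝒲` of `n × m` real matrices: pairs `(Q, D)` of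
invertible diagonal matrices with `Q * M * D⁻¹ ∈ 𝒲` for every `M ∈ 𝒲`. -/
def scaleGauge {n m : Type*} [Fintype n] [Fintype m] [DecidableEq n] [DecidableEq m]
    (𝒲 : Set (Matrix n m ℝ)) : Set (Matrix n n ℝ × Matrix m m ℝ) :=
  {QD | QD.1.IsDiag ∧ IsUnit QD.1 ∧ QD.2.IsDiag ∧ IsUnit QD.2 ∧
    ∀ M ∈ 𝒲, QD.1 * M * QD.2⁻¹ ∈ 𝒲}

theorem cnn_gauge_strict_subset_of_mlp_gauge
    (H W p q : ℕ) (hH : 0 < H) (hW : 0 < W) (hp : 0 < p) (hq : 0 < q)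
    (hpH : p ≤ H) (hqW : q ≤ W) (hn : 2 ≤ (H - p + 1) * (W - q + 1)) :
    scaleGauge (Set.univ :
        Set (Matrix (Fin (H - p + 1) × Fin (W - q + 1)) (Fin H × Fin W) ℝ)) =
      {QD | QD.1.IsDiag ∧ IsUnit QD.1 ∧ QD.2.IsDiag ∧ IsUnit QD.2} ∧
    scaleGauge (convSpace H W p q) ⊂
      scaleGauge (Set.univ :
        Set (Matrix (Fin (H - p + 1) × Fin (W - q + 1)) (Fin H × Fin W) ℝ)) := by
  have huniv : scaleGauge (Set.univ :
        Set (Matrix (Fin (H - p + 1) × Fin (W - q + 1)) (Fin H × Fin W) ℝ)) =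
      {QD | QD.1.IsDiag ∧ IsUnit QD.1 ∧ QD.2.IsDiag ∧ IsUnit QD.2} := by
    ext QD
    simp [scaleGauge]
  refine ⟨huniv, ?_⟩
  rw [huniv, Set.ssubset_iff_subset_ne]
  refine ⟨fun QD h => ⟨h.1, h.2.1, h.2.2.1, h.2.2.2.1⟩, fun heq => ?_⟩
  let v : Fin (H - p + 1) × Fin (W - q + 1) → ℝ := fun ab => if ab = (0, 0) then 2 else 1
  have hv : ∀ ab, v ab ≠ 0 := by
    intro ab
    by_cases h : ab = (0, 0) <;> simp [v, h]
  have hmem : ((Matrix.diagonal v, 1) :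
      Matrix (Fin (H - p + 1) × Fin (W - q + 1)) (Fin (H - p + 1) × Fin (W - q + 1)) ℝ ×
      Matrix (Fin H × Fin W) (Fin H × Fin W) ℝ) ∈ scaleGauge (convSpace H W p q) := by
    rw [heq]
    refine ⟨Matrix.isDiag_diagonal v, ?_, Matrix.isDiag_one, isUnit_one⟩
    rw [Matrix.isUnit_diagonal, Pi.isUnit_iff]
    exact fun ab => (hv ab).isUnit
  obtain ⟨k, hk⟩ := hmem.2.2.2.2 _ ⟨fun _ _ => 1, rfl⟩
  simp only [inv_one, Matrix.mul_one] at hk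
  have key : ∀ (k : Fin p → Fin q → ℝ) (a : Fin (H - p + 1)) (b : Fin (W - q + 1)),
      convMatrix H W p q k (a, b) (⟨a, by omega⟩, ⟨b, by omega⟩) = k ⟨0, hp⟩ ⟨0, hq⟩ := by
    intro k a b
    simp [convMatrix, hp, hq]
  have hval : ∀ a b, k ⟨0, hp⟩ ⟨0, hq⟩ = v (a, b) := by
    intro a b
    rw [← key k a b, hk, Matrix.diagonal_mul, key, mul_one]
  have h0 := hval 0 0
  have h1 := hval (Fin.last _) (Fin.last _)
  have hne : ¬ (((Fin.last (H - p), Fin.last (W - q)) :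
      Fin (H - p + 1) × Fin (W - q + 1)) = (0, 0)) := by
    intro h
    have ha : H - p = 0 := by simpa using congrArg (fun x => (x.1 : ℕ)) h
    have hb : W - q = 0 := by simpa using congrArg (fun x => (x.2 : ℕ)) h
    rw [ha, hb] at hn
    omega
  rw [h0] at h1
  simp only [v, if_neg hne, if_true] at h1
  norm_num at h1
end

section
/- Let H, W, p, q be positive integers with p ≤ H, q ≤ W, and (H−p+1)(W−q+1) ≥ 2, and set n = (H−p+1)(W−q+1), m = HW. Define the ReLU-restricted gauge group G⁺_scale(𝒲) as the set of pairs (Q, D) of diagonal matrices with strictly positive diagonal entries such that Q W D⁻¹ ∈ 𝒲 for all W ∈ 𝒲. Then G⁺_scale(𝒲_CNN(H,W,p,q)) is a strict subset of G⁺_scale(ℝ^{n×m}), and G⁺_scale(ℝ^{n×m}) consists of all pairs of positive diagonal matrices. -/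
open Matrix

/-- The ReLU-restricted scaling gauge group of a set `𝒲` of `n × m` real matrices:
pairs `(Q, D)` of diagonal matrices with strictly positive diagonal entries such that
`Q * M * D⁻¹ ∈ 𝒲` for every `M ∈ 𝒲`. -/
def posScaleGauge {n m : Type*} [Fintype n] [Fintype m] [DecidableEq n] [DecidableEq m]
    (𝒲 : Set (Matrix n m ℝ)) : Set (Matrix n n ℝ × Matrix m m ℝ) :=
  {QD | QD.1.IsDiag ∧ (∀ i, 0 < QD.1 i i) ∧ QD.2.IsDiag ∧ (∀ j, 0 < QD.2 j j) ∧
    ∀ M ∈ 𝒲, QD.1 * M * QD.2⁻¹ ∈ 𝒲}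

theorem cnn_pos_gauge_strict_subset_of_mlp_pos_gauge
    (H W p q : ℕ) (hH : 0 < H) (hW : 0 < W) (hp : 0 < p) (hq : 0 < q)
    (hpH : p ≤ H) (hqW : q ≤ W) (hn : 2 ≤ (H - p + 1) * (W - q + 1)) :
    posScaleGauge (convSpace H W p q) ⊂
      posScaleGauge (Set.univ :
        Set (Matrix (Fin (H - p + 1) × Fin (W - q + 1)) (Fin H × Fin W) ℝ)) ∧
    posScaleGauge (Set.univ :
        Set (Matrix (Fin (H - p + 1) × Fin (W - q + 1)) (Fin H × Fin W) ℝ)) =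
      {QD | QD.1.IsDiag ∧ (∀ i, 0 < QD.1 i i) ∧ QD.2.IsDiag ∧ (∀ j, 0 < QD.2 j j)} := by
  have huniv : posScaleGauge (Set.univ :
        Set (Matrix (Fin (H - p + 1) × Fin (W - q + 1)) (Fin H × Fin W) ℝ)) =
      {QD | QD.1.IsDiag ∧ (∀ i, 0 < QD.1 i i) ∧ QD.2.IsDiag ∧ (∀ j, 0 < QD.2 j j)} := by
    ext QD
    simp [posScaleGauge]
  refine ⟨?_, huniv⟩
  rw [huniv, Set.ssubset_iff_subset_ne]
  refine ⟨fun QD h => ⟨h.1, h.2.1, h.2.2.1, h.2.2.2.1⟩, fun heq => ?_⟩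
  have hcard : 1 < Fintype.card (Fin (H - p + 1) × Fin (W - q + 1)) := by
    simp only [Fintype.card_prod, Fintype.card_fin]
    omega
  haveI := Fintype.one_lt_card_iff_nontrivial.mp hcard
  obtain ⟨ab, hab⟩ := exists_ne ((0, 0) : Fin (H - p + 1) × Fin (W - q + 1))
  let f : Fin (H - p + 1) × Fin (W - q + 1) → ℝ := fun x => if x = (0, 0) then 2 else 1
  have hmem : ((Matrix.diagonal f, 1) :
      Matrix (Fin (H - p + 1) × Fin (W - q + 1)) (Fin (H - p + 1) × Fin (W - q + 1)) ℝ ×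
        Matrix (Fin H × Fin W) (Fin H × Fin W) ℝ) ∈
      posScaleGauge (convSpace H W p q) := by
    rw [heq]
    refine ⟨Matrix.isDiag_diagonal f, fun i => ?_, Matrix.isDiag_one, fun j => ?_⟩
    · simp only [Matrix.diagonal_apply_eq, f]
      split_ifs <;> norm_num
    · simp
  obtain ⟨k, hk⟩ := hmem.2.2.2.2 _ ⟨fun _ _ => 1, rfl⟩
  -- each diagonal-type entry `((a,b),(a,b))` reads off the kernel value at the origin
  have key : ∀ x : Fin (H - p + 1) × Fin (W - q + 1), k ⟨0, hp⟩ ⟨0, hq⟩ = f x := by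
    intro x
    have h1 : (x.1 : ℕ) < H := by have := x.1.2; omega
    have h2 : (x.2 : ℕ) < W := by have := x.2.2; omega
    have := congrFun (congrFun hk x) (⟨x.1, h1⟩, ⟨x.2, h2⟩)
    simpa [convMatrix, hp, hq, Matrix.diagonal_mul] using this
  have h0 := key (0, 0)
  have h1 := key ab
  rw [h0] at h1
  simp [f, hab] at h1
end

section
/- Let H, W, p, q be positive integers with p ≤ H, q ≤ W, and (H−p+1)(W−q+1) ≥ 2, and set n = (H−p+1)(W−q+1), m = HW. Define the tanh-restricted gauge group G^±_scale(𝒲) as the set of pairs (Q, D) of diagonal matrices all of whose diagonal entries lie in {−1, +1} such that Q W D⁻¹ ∈ 𝒲 for all W ∈ 𝒲. Then G^±_scale(𝒲_CNN(H,W,p,q)) is a strict subset of G^±_scale(ℝ^{n×m}), and G^±_scale(ℝ^{n×m}) consists of all pairs of sign diagonal matrices. -/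
open Matrix

/-- The tanh-restricted scaling gauge group of a set `𝒲` of `n × m` real matrices:
pairs `(Q, D)` of diagonal matrices all of whose diagonal entries lie in `{-1, +1}`
such that `Q * M * D⁻¹ ∈ 𝒲` for every `M ∈ 𝒲`. -/
def signScaleGauge {n m : Type*} [Fintype n] [Fintype m] [DecidableEq n] [DecidableEq m]
    (𝒲 : Set (Matrix n m ℝ)) : Set (Matrix n n ℝ × Matrix m m ℝ) :=
  {QD | QD.1.IsDiag ∧ (∀ i, QD.1 i i = 1 ∨ QD.1 i i = -1) ∧
    QD.2.IsDiag ∧ (∀ j, QD.2 j j = 1 ∨ QD.2 j j = -1) ∧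
    ∀ M ∈ 𝒲, QD.1 * M * QD.2⁻¹ ∈ 𝒲}

theorem cnn_sign_gauge_strict_subset_of_mlp_sign_gauge
    (H W p q : ℕ) (hH : 0 < H) (hW : 0 < W) (hp : 0 < p) (hq : 0 < q)
    (hpH : p ≤ H) (hqW : q ≤ W) (hn : 2 ≤ (H - p + 1) * (W - q + 1)) :
    signScaleGauge (convSpace H W p q) ⊂
      signScaleGauge (Set.univ :
        Set (Matrix (Fin (H - p + 1) × Fin (W - q + 1)) (Fin H × Fin W) ℝ)) ∧
    signScaleGauge (Set.univ :
        Set (Matrix (Fin (H - p + 1) × Fin (W - q + 1)) (Fin H × Fin W) ℝ)) =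
      {QD | QD.1.IsDiag ∧ (∀ i, QD.1 i i = 1 ∨ QD.1 i i = -1) ∧
        QD.2.IsDiag ∧ (∀ j, QD.2 j j = 1 ∨ QD.2 j j = -1)} := by
  have huniv : signScaleGauge (Set.univ :
        Set (Matrix (Fin (H - p + 1) × Fin (W - q + 1)) (Fin H × Fin W) ℝ)) =
      {QD | QD.1.IsDiag ∧ (∀ i, QD.1 i i = 1 ∨ QD.1 i i = -1) ∧
        QD.2.IsDiag ∧ (∀ j, QD.2 j j = 1 ∨ QD.2 j j = -1)} := by
    ext QD
    simp [signScaleGauge]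
  refine ⟨?_, huniv⟩
  rw [huniv, Set.ssubset_iff_subset_ne]
  refine ⟨fun QD h => ⟨h.1, h.2.1, h.2.2.1, h.2.2.2.1⟩, fun heq => ?_⟩
  -- a second output position
  obtain ⟨i, hi⟩ : ∃ i : Fin (H - p + 1) × Fin (W - q + 1), i ≠ (0, 0) := by
    have hc : 1 < Fintype.card (Fin (H - p + 1) × Fin (W - q + 1)) := by
      simp only [Fintype.card_prod, Fintype.card_fin]; exact hn
    have := Fintype.one_lt_card_iff_nontrivial.mp hc
    exact exists_ne _
  let v : Fin (H - p + 1) × Fin (W - q + 1) → ℝ := fun j => if j = (0, 0) then -1 else 1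
  have hmem : ((Matrix.diagonal v, 1) :
      Matrix _ _ ℝ × Matrix (Fin H × Fin W) (Fin H × Fin W) ℝ) ∈
      signScaleGauge (convSpace H W p q) := by
    rw [heq]
    refine ⟨Matrix.isDiag_diagonal v, fun j => ?_, Matrix.isDiag_one, fun j => by simp⟩
    by_cases hj : j = (0, 0)
    · right; simp [v, hj]
    · left; simp [v, hj]
  obtain ⟨k', hk'⟩ := hmem.2.2.2.2 _ ⟨fun _ _ => 1, rfl⟩
  -- the diagonal entries all read the kernel at the origin
  have key : ∀ j : Fin (H - p + 1) × Fin (W - q + 1), k' ⟨0, hp⟩ ⟨0, hq⟩ = v j := by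
    intro j
    have h1 : (j.1 : ℕ) < H := by have := j.1.isLt; omega
    have h2 : (j.2 : ℕ) < W := by have := j.2.isLt; omega
    have := congrFun (congrFun hk' j) (⟨j.1, h1⟩, ⟨j.2, h2⟩)
    simpa [convMatrix, hp, hq, Matrix.diagonal_mul] using this
  have h0 := key (0, 0)
  have h1 := key i
  rw [h0] at h1
  simp [v, hi] at h1
  norm_num at h1
end
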